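/- Assume E[(1 + |X| + |X|²) · Λ(W,X)] < ∞ and that the quadratic form Γ is positive definite on ℝ^{ī·j̄}. Then the global identifiability property holds: Ȳ(θ) < 0 for every parameter θ ≠ θ*; equivalently, Ȳ(θ) = 0 if and only if θ = θ*. -/

import Mathlib

open scoped BigOperators
open MeasureTheory

/-- Euclidean inner product on `ℝ^{j̄}`. -/
noncomputable def dot {n : ℕ} (x y : Fin n → ℝ) : ℝ := ∑ j, x j * y j

/-- Euclidean norm on `ℝ^{j̄}` (coordinates indexed by `Fin n`). -/
noncomputable def normE {n : ℕ} (x : Fin n → ℝ) : ℝ := Real.sqrt (∑ j, (x j) ^ 2)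

/-- The ratio (softmax) function `ρ^i(x,θ)` for a full parameter family
`θ : I → ℝ^{j̄}` (indices `I = {0,…,ī}`). -/
noncomputable def rho {ibar jbar : ℕ} (x : Fin jbar → ℝ)
    (θ : Fin (ibar + 1) → Fin jbar → ℝ) (i : Fin (ibar + 1)) : ℝ :=
  (∑ i', Real.exp (dot x (θ i' - θ i)))⁻¹

/-- Extend a parameter `θ = (θ^α)_{α∈I₀}` to `I = {0,…,ī}` by pinning `θ^0 = 0`. -/
noncomputable def pad {ibar jbar : ℕ} (θ : Fin ibar → Fin jbar → ℝ) :
    Fin (ibar + 1) → Fin jbar → ℝ :=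
  Fin.cases 0 θ

/-- `Λ(w,x) = w ∑_{i∈I} exp(x·ϑ^{*i})`. -/
noncomputable def Lam {ibar jbar : ℕ} (ϑs : Fin (ibar + 1) → Fin jbar → ℝ)
    (w : ℝ) (x : Fin jbar → ℝ) : ℝ :=
  w * ∑ i, Real.exp (dot x (ϑs i))

/-- `θ* = (ϑ^{*i} − ϑ^{*0})_{i∈I₀}`. -/
noncomputable def thetaStar {ibar jbar : ℕ} (ϑs : Fin (ibar + 1) → Fin jbar → ℝ) :
    Fin ibar → Fin jbar → ℝ :=
  fun α => ϑs α.succ - ϑs 0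

/-- The integrand of `Ȳ(θ)`:
`ω ↦ ∑_{i∈I} log(ρ^i(X,θ)/ρ^i(X,θ*)) ρ^i(X,θ*) Λ(W,X)`. -/
noncomputable def YbarInt {ibar jbar : ℕ} {Ω : Type*}
    (X : Ω → Fin jbar → ℝ) (W : Ω → ℝ) (ϑs : Fin (ibar + 1) → Fin jbar → ℝ)
    (θ : Fin ibar → Fin jbar → ℝ) (ω : Ω) : ℝ :=
  (∑ i : Fin (ibar + 1),
    Real.log (rho (X ω) (pad θ) i / rho (X ω) (pad (thetaStar ϑs)) i) *
      rho (X ω) (pad (thetaStar ϑs)) i) * Lam ϑs (W ω) (X ω)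

/-- `Ȳ(θ) = E[∑_{i∈I} log(ρ^i(X,θ)/ρ^i(X,θ*)) ρ^i(X,θ*) Λ(W,X)]`. -/
noncomputable def Ybar {ibar jbar : ℕ} {Ω : Type*} [MeasurableSpace Ω]
    (P : Measure Ω) (X : Ω → Fin jbar → ℝ) (W : Ω → ℝ)
    (ϑs : Fin (ibar + 1) → Fin jbar → ℝ) (θ : Fin ibar → Fin jbar → ℝ) : ℝ :=
  ∫ ω, YbarInt X W ϑs θ ω ∂P

/-- The integrand of the quadratic form `Γ[u⊗u]`:
`ω ↦ (V₀(X,θ*) ⊗ X ⊗ X)[u⊗u] Λ(W,X)`. -/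
noncomputable def GamInt {ibar jbar : ℕ} {Ω : Type*}
    (X : Ω → Fin jbar → ℝ) (W : Ω → ℝ) (ϑs : Fin (ibar + 1) → Fin jbar → ℝ)
    (u : Fin ibar → Fin jbar → ℝ) (ω : Ω) : ℝ :=
  (∑ α : Fin ibar, ∑ α' : Fin ibar, ∑ j : Fin jbar, ∑ j' : Fin jbar,
    ((if α = α' then rho (X ω) (pad (thetaStar ϑs)) α.succ else 0) -
      rho (X ω) (pad (thetaStar ϑs)) α.succ *
        rho (X ω) (pad (thetaStar ϑs)) α'.succ) *
      X ω j * X ω j' * u α j * u α' j') * Lam ϑs (W ω) (X ω)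

/-- The quadratic form `Γ[u⊗u] = E[(V₀(X,θ*) ⊗ X ⊗ X)[u⊗u] Λ(W,X)]`. -/
noncomputable def Gam {ibar jbar : ℕ} {Ω : Type*} [MeasurableSpace Ω]
    (P : Measure Ω) (X : Ω → Fin jbar → ℝ) (W : Ω → ℝ)
    (ϑs : Fin (ibar + 1) → Fin jbar → ℝ) (u : Fin ibar → Fin jbar → ℝ) : ℝ :=
  ∫ ω, GamInt X W ϑs u ω ∂P

lemma aux_dot_sub {n : ℕ} (x y z : Fin n → ℝ) : dot x (y - z) = dot x y - dot x z := by
  simp [dot, mul_sub, Finset.sum_sub_distrib]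

lemma aux_dot_le {n : ℕ} (x y : Fin n → ℝ) : dot x y ≤ normE x * normE y := by
  unfold dot normE
  exact Real.sum_mul_le_sqrt_mul_sqrt _ _ _

lemma aux_rho_eq {a b : ℕ} (x : Fin b → ℝ) (θ : Fin (a + 1) → Fin b → ℝ) (i : Fin (a + 1)) :
    rho x θ i = Real.exp (dot x (θ i)) / ∑ k, Real.exp (dot x (θ k)) := by
  unfold rho
  simp only [aux_dot_sub, Real.exp_sub]
  rw [← Finset.sum_div, inv_div]

lemma aux_S_pos {a b : ℕ} (x : Fin b → ℝ) (θ : Fin (a + 1) → Fin b → ℝ) :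
    0 < ∑ k, Real.exp (dot x (θ k)) :=
  Finset.sum_pos (fun _ _ => Real.exp_pos _) Finset.univ_nonempty

lemma aux_rho_pos {a b : ℕ} (x : Fin b → ℝ) (θ : Fin (a + 1) → Fin b → ℝ) (i : Fin (a + 1)) :
    0 < rho x θ i := by
  rw [aux_rho_eq]; exact div_pos (Real.exp_pos _) (aux_S_pos x θ)

lemma aux_rho_sum {a b : ℕ} (x : Fin b → ℝ) (θ : Fin (a + 1) → Fin b → ℝ) :
    ∑ i, rho x θ i = 1 := by
  simp only [aux_rho_eq]
  rw [← Finset.sum_div, div_self (aux_S_pos x θ).ne']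

lemma aux_rho_le {a b : ℕ} (x : Fin b → ℝ) (θ : Fin (a + 1) → Fin b → ℝ) (i : Fin (a + 1)) :
    rho x θ i ≤ 1 := by
  rw [← aux_rho_sum x θ]
  exact Finset.single_le_sum (f := fun i => rho x θ i)
    (fun k _ => (aux_rho_pos x θ k).le) (Finset.mem_univ i)

lemma aux_term {p q : ℝ} (hp : 0 < p) (hq : 0 < q) : Real.log (q / p) * p ≤ q - p := by
  have h := Real.log_le_sub_one_of_pos (div_pos hq hp)
  calc _ ≤ (q / p - 1) * p := by gcongr
    _ = q - p := by field_simp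

lemma aux_term_eq {p q : ℝ} (hp : 0 < p) (hq : 0 < q) (h : Real.log (q / p) * p = q - p) :
    q = p := by
  by_contra hne
  have h1 : q / p ≠ 1 := fun h1 => hne ((div_eq_one_iff_eq hp.ne').1 h1)
  have h := Real.log_lt_sub_one_of_pos (div_pos hq hp) h1
  have : Real.log (q / p) * p < (q / p - 1) * p := by gcongr
  have h2 : (q / p - 1) * p = q - p := by field_simp
  linarith

lemma aux_kl_le {n : ℕ} (p q : Fin n → ℝ) (hp : ∀ i, 0 < p i) (hq : ∀ i, 0 < q i)
    (hs : ∑ i, p i = ∑ i, q i) : ∑ i, Real.log (q i / p i) * p i ≤ 0 := by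
  calc _ ≤ ∑ i, (q i - p i) := Finset.sum_le_sum fun i _ => aux_term (hp i) (hq i)
    _ = 0 := by rw [Finset.sum_sub_distrib, hs, sub_self]

lemma aux_kl_eq {n : ℕ} (p q : Fin n → ℝ) (hp : ∀ i, 0 < p i) (hq : ∀ i, 0 < q i)
    (hs : ∑ i, p i = ∑ i, q i) (h0 : ∑ i, Real.log (q i / p i) * p i = 0) (i : Fin n) :
    q i = p i := by
  have h : ∑ i, Real.log (q i / p i) * p i = ∑ i, (q i - p i) := by
    rw [h0, Finset.sum_sub_distrib, hs, sub_self]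
  have := (Finset.sum_eq_sum_iff_of_le fun i _ => aux_term (hp i) (hq i)).1 h i (Finset.mem_univ i)
  exact aux_term_eq (hp i) (hq i) this

lemma aux_rho_inj {a b : ℕ} (x : Fin b → ℝ) (θ η : Fin a → Fin b → ℝ)
    (h : ∀ i, rho x (pad θ) i = rho x (pad η) i) (α : Fin a) : dot x (θ α - η α) = 0 := by
  have h0 := h 0
  have h1 := h α.succ
  simp only [aux_rho_eq] at h0 h1
  have e1 := aux_S_pos x (pad θ)
  have e2 := aux_S_pos x (pad η)
  have z : ∀ θ : Fin a → Fin b → ℝ, dot x (pad θ 0) = 0 := by intro θ; simp [pad, dot]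
  have s : ∀ θ : Fin a → Fin b → ℝ, pad θ α.succ = θ α := by intro θ; simp [pad]
  rw [z, z, Real.exp_zero, div_eq_div_iff e1.ne' e2.ne', one_mul, one_mul] at h0
  rw [s, s, h0] at h1
  have := Real.exp_injective ((div_left_inj' e1.ne').1 h1)
  rw [aux_dot_sub, this, sub_self]

lemma aux_log_bound {a b : ℕ} (θ : Fin (a + 1) → Fin b → ℝ) : ∃ C : ℝ, 0 ≤ C ∧
    ∀ (x : Fin b → ℝ) (i : Fin (a + 1)), - (C * (1 + normE x)) ≤ Real.log (rho x θ i) := by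
  have nn : ∀ {n : ℕ} (y : Fin n → ℝ), 0 ≤ normE y := fun y => Real.sqrt_nonneg _
  set K : ℝ := ∑ i, ∑ k, normE (θ k - θ i) with hK
  have hK0 : 0 ≤ K := Finset.sum_nonneg fun _ _ => Finset.sum_nonneg fun _ _ => nn _
  have hn : (0:ℝ) < (a + 1 : ℕ) := by positivity
  have hl : 0 ≤ Real.log ((a + 1 : ℕ) : ℝ) := Real.log_natCast_nonneg _
  refine ⟨Real.log ((a + 1 : ℕ) : ℝ) + K, by positivity, fun x i => ?_⟩
  unfold rho
  rw [Real.log_inv, neg_le_neg_iff]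
  have h1 : ∑ k, Real.exp (dot x (θ k - θ i)) ≤ ((a + 1 : ℕ) : ℝ) * Real.exp (K * normE x) := by
    calc _ ≤ ∑ _k : Fin (a + 1), Real.exp (K * normE x) := by
          refine Finset.sum_le_sum fun k _ => Real.exp_le_exp.2 ?_
          refine (aux_dot_le _ _).trans ?_
          rw [mul_comm]
          refine mul_le_mul_of_nonneg_right ?_ (nn x)
          refine (Finset.single_le_sum (f := fun k => normE (θ k - θ i))
            (fun k _ => nn _) (Finset.mem_univ k)).trans ?_
          exact Finset.single_le_sum (f := fun i => ∑ k, normE (θ k - θ i))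
            (fun k _ => Finset.sum_nonneg fun _ _ => nn _) (Finset.mem_univ i)
      _ = _ := by simp
  have h2 := Real.log_le_log (Finset.sum_pos (fun _ _ => Real.exp_pos _) Finset.univ_nonempty) h1
  rw [Real.log_mul hn.ne' (Real.exp_pos _).ne', Real.log_exp] at h2
  have := mul_nonneg hl (nn x)
  nlinarith

lemma aux_meas {a b : ℕ} {Ω : Type*} [MeasurableSpace Ω]
    (X : Ω → Fin b → ℝ) (W : Ω → ℝ) (hX : Measurable X) (hW : Measurable W)
    (ϑs : Fin (a + 1) → Fin b → ℝ) (θ : Fin a → Fin b → ℝ) :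
    Measurable (YbarInt X W ϑs θ) := by
  have hd : ∀ y : Fin b → ℝ, Measurable fun ω => dot (X ω) y := by
    intro y; unfold dot; fun_prop
  have hr : ∀ (η : Fin (a + 1) → Fin b → ℝ) i, Measurable fun ω => rho (X ω) η i := by
    intro η i; unfold rho
    exact (Finset.measurable_sum _ fun k _ => Real.measurable_exp.comp (hd _)).inv
  unfold YbarInt Lam
  refine Measurable.mul (Finset.measurable_sum _ fun i _ => ?_)
    (hW.mul (Finset.measurable_sum _ fun k _ => Real.measurable_exp.comp (hd _)))
  exact (Real.measurable_log.comp ((hr _ i).div (hr _ i))).mul (hr _ i)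

lemma aux_Lam_nonneg {a b : ℕ} (ϑs : Fin (a + 1) → Fin b → ℝ) {w : ℝ} (hw : 0 ≤ w)
    (x : Fin b → ℝ) : 0 ≤ Lam ϑs w x := mul_nonneg hw (aux_S_pos x ϑs).le

lemma aux_nonpos {a b : ℕ} {Ω : Type*}
    (X : Ω → Fin b → ℝ) (W : Ω → ℝ) (hWpos : ∀ ω, 0 ≤ W ω)
    (ϑs : Fin (a + 1) → Fin b → ℝ) (θ : Fin a → Fin b → ℝ) (ω : Ω) :
    YbarInt X W ϑs θ ω ≤ 0 :=
  mul_nonpos_of_nonpos_of_nonneg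
    (aux_kl_le _ _ (fun i => aux_rho_pos _ _ i) (fun i => aux_rho_pos _ _ i)
      (by rw [aux_rho_sum, aux_rho_sum]))
    (aux_Lam_nonneg ϑs (hWpos ω) _)

lemma aux_integrable {a b : ℕ} {Ω : Type*} [MeasurableSpace Ω] (P : Measure Ω)
    (X : Ω → Fin b → ℝ) (W : Ω → ℝ) (hX : Measurable X) (hW : Measurable W)
    (hWpos : ∀ ω, 0 ≤ W ω) (ϑs : Fin (a + 1) → Fin b → ℝ) (θ : Fin a → Fin b → ℝ)
    (hint : Integrable
      (fun ω => (1 + normE (X ω) + normE (X ω) ^ 2) * Lam ϑs (W ω) (X ω)) P) :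
    Integrable (YbarInt X W ϑs θ) P := by
  obtain ⟨C, hC0, hC⟩ := aux_log_bound (pad θ)
  refine (hint.const_mul C).mono' (aux_meas X W hX hW ϑs θ).aestronglyMeasurable
    (Filter.Eventually.of_forall fun ω => ?_)
  rw [Real.norm_of_nonpos (aux_nonpos X W hWpos ϑs θ ω)]
  have hL := aux_Lam_nonneg ϑs (hWpos ω) (X ω)
  unfold YbarInt
  rw [← neg_mul, ← mul_assoc]
  refine mul_le_mul_of_nonneg_right ?_ hL
  have hn : 0 ≤ normE (X ω) := Real.sqrt_nonneg _
  have h1 : ∑ i, -(C * (1 + normE (X ω))) * rho (X ω) (pad (thetaStar ϑs)) i ≤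
      ∑ i, Real.log (rho (X ω) (pad θ) i / rho (X ω) (pad (thetaStar ϑs)) i) *
      rho (X ω) (pad (thetaStar ϑs)) i := by
    refine Finset.sum_le_sum fun i _ =>
      mul_le_mul_of_nonneg_right ?_ (aux_rho_pos _ _ i).le
    have hp := aux_rho_pos (X ω) (pad (thetaStar ϑs)) i
    rw [Real.log_div (aux_rho_pos _ _ i).ne' hp.ne']
    have := Real.log_nonpos hp.le (aux_rho_le (X ω) (pad (thetaStar ϑs)) i)
    have := hC (X ω) i
    linarith
  rw [← Finset.mul_sum, aux_rho_sum] at h1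
  have : 0 ≤ C * normE (X ω) ^ 2 := by positivity
  linarith

lemma aux_gam_zero {a b : ℕ} (x : Fin b → ℝ) (u : Fin a → Fin b → ℝ) (c : Fin a → Fin a → ℝ)
    (h : ∀ α, dot x (u α) = 0) :
    ∑ α : Fin a, ∑ α' : Fin a, ∑ j : Fin b, ∑ j' : Fin b,
      c α α' * x j * x j' * u α j * u α' j' = 0 := by
  refine Finset.sum_eq_zero fun α _ => Finset.sum_eq_zero fun α' _ =>
    Finset.sum_eq_zero fun j _ => ?_
  have : ∑ j' : Fin b, c α α' * x j * x j' * u α j * u α' j' =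
      c α α' * x j * u α j * dot x (u α') := by
    rw [dot, Finset.mul_sum]
    exact Finset.sum_congr rfl fun _ _ => by ring
  rw [this, h, mul_zero]

/-- if `E[(1 + |X| + |X|²)·Λ(W,X)] < ∞` and the quadratic form `Γ`
is positive definite on `ℝ^{ī·j̄}`, then the global identifiability property
holds: `Ȳ(θ) < 0` for every parameter `θ ≠ θ*`; equivalently, `Ȳ(θ) = 0` if and
only if `θ = θ*`. -/
theorem statement9 (ibar jbar : ℕ) (hibar : 1 ≤ ibar) (hjbar : 1 ≤ jbar)
    {Ω : Type*} [MeasurableSpace Ω] (P : Measure Ω) [IsProbabilityMeasure P]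
    (X : Ω → Fin jbar → ℝ) (W : Ω → ℝ)
    (hX : Measurable X) (hW : Measurable W) (hWpos : ∀ ω, 0 ≤ W ω)
    (ϑs : Fin (ibar + 1) → Fin jbar → ℝ)
    (hint : Integrable
      (fun ω => (1 + normE (X ω) + normE (X ω) ^ 2) * Lam ϑs (W ω) (X ω)) P)
    (hΓ : ∀ u : Fin ibar → Fin jbar → ℝ, u ≠ 0 → 0 < Gam P X W ϑs u) :
    (∀ θ : Fin ibar → Fin jbar → ℝ, θ ≠ thetaStar ϑs → Ybar P X W ϑs θ < 0) ∧
    (∀ θ : Fin ibar → Fin jbar → ℝ, Ybar P X W ϑs θ = 0 ↔ θ = thetaStar ϑs) := by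
  have key : ∀ θ : Fin ibar → Fin jbar → ℝ, θ ≠ thetaStar ϑs → Ybar P X W ϑs θ < 0 := by
    intro θ hθ
    have hle : Ybar P X W ϑs θ ≤ 0 := integral_nonpos (aux_nonpos X W hWpos ϑs θ)
    refine lt_of_le_of_ne hle fun h0 => ?_
    have hi := aux_integrable P X W hX hW hWpos ϑs θ hint
    have h0' : ∫ ω, -YbarInt X W ϑs θ ω ∂P = 0 := by
      rw [integral_neg, neg_eq_zero]; exact h0
    have hae := (integral_eq_zero_iff_of_nonneg
      (fun ω => neg_nonneg.2 (aux_nonpos X W hWpos ϑs θ ω)) hi.neg).1 h0'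
    have hG := hΓ (θ - thetaStar ϑs) (sub_ne_zero.2 hθ)
    have hz : Gam P X W ϑs (θ - thetaStar ϑs) = 0 := by
      refine integral_eq_zero_of_ae ?_
      filter_upwards [hae] with ω hω
      have hω' : YbarInt X W ϑs θ ω = 0 := neg_eq_zero.1 hω
      show GamInt X W ϑs (θ - thetaStar ϑs) ω = 0
      unfold YbarInt at hω'
      unfold GamInt
      rcases mul_eq_zero.1 hω' with hk | hL
      · have hr := aux_kl_eq _ _ (fun i => aux_rho_pos _ _ i) (fun i => aux_rho_pos _ _ i)
          (by rw [aux_rho_sum, aux_rho_sum]) hk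
        have hd := aux_rho_inj (X ω) θ (thetaStar ϑs) hr
        rw [aux_gam_zero (X ω) (θ - thetaStar ϑs) (fun α α' =>
          (if α = α' then rho (X ω) (pad (thetaStar ϑs)) α.succ else 0) -
            rho (X ω) (pad (thetaStar ϑs)) α.succ *
            rho (X ω) (pad (thetaStar ϑs)) α'.succ) hd, zero_mul]
      · rw [hL, mul_zero]
    linarith
  refine ⟨key, fun θ => ⟨fun h => ?_, ?_⟩⟩
  · by_contra hne
    exact (key θ hne).ne h
  · rintro rfl
    have : ∀ ω, YbarInt X W ϑs (thetaStar ϑs) ω = 0 := by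
      intro ω
      unfold YbarInt
      have : ∀ i, rho (X ω) (pad (thetaStar ϑs)) i / rho (X ω) (pad (thetaStar ϑs)) i = 1 :=
        fun i => div_self (aux_rho_pos _ _ i).ne'
      simp [this]
    simp [Ybar, this]
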